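/- Let V be a finite type, E : V → V → Prop a directed graph relation (the type-I lines of the doubly-contracted diagram, oriented along their arrowheads), and Ext : Set V a set of 'external' vertices. Assume (a) acyclicity: for every v, ¬ Relation.TransGen E v v; and (b) balance at internal vertices: for every v ∉ Ext, (∃ u, E u v) ↔ (∃ w, E v w). Then every connected component containing an edge contains at least two external vertices: for all a b with E a b, there exist x, y ∈ Ext with x ≠ y such that both x and y are joined to a by the reflexive-transitive closure of the symmetrized relation (fun u v => E u v ∨ E v u). (Proposition 3: each I-connected (II-connected) component contains at least two external vertices.) -/

import Mathlib

/-- In a finite acyclic directed graph where every vertex outside `S` with an outgoing edge also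
has an incoming one, every vertex with an outgoing edge is reachable from `S`. -/
theorem exists_mem_reflTransGen_of_acyclic {V : Type*} [Finite V] {E : V → V → Prop} {S : Set V}
    (hacyc : ∀ v : V, ¬ Relation.TransGen E v v)
    (hin : ∀ v : V, v ∉ S → (∃ w, E v w) → ∃ u, E u v) {v : V} (hv : ∃ w, E v w) :
    ∃ x ∈ S, Relation.ReflTransGen E x v := by
  have : Std.Irrefl (Relation.TransGen E) := ⟨hacyc⟩
  have hwf : WellFounded (Relation.TransGen E) := Finite.wellFounded_of_trans_of_irrefl _
  induction v using hwf.induction with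
  | _ v ih =>
    by_cases hS : v ∈ S
    · exact ⟨v, hS, .refl⟩
    · obtain ⟨u, hu⟩ := hin v hS hv
      obtain ⟨x, hx, hxu⟩ := ih u (.single hu) ⟨v, hu⟩
      exact ⟨x, hx, hxu.tail hu⟩

/-- Proposition 3: each I-connected (II-connected) component containing an
edge contains at least two external vertices. -/
theorem component_contains_two_external_vertices
    {V : Type*} [Fintype V] (E : V → V → Prop) (Ext : Set V)
    (hacyc : ∀ v : V, ¬ Relation.TransGen E v v)
    (hbal : ∀ v : V, v ∉ Ext → ((∃ u, E u v) ↔ (∃ w, E v w))) :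
    ∀ a b : V, E a b →
      ∃ x ∈ Ext, ∃ y ∈ Ext, x ≠ y ∧
        Relation.ReflTransGen (fun u v => E u v ∨ E v u) x a ∧
        Relation.ReflTransGen (fun u v => E u v ∨ E v u) y a := by
  intro a b hab
  obtain ⟨x, hx, hxa⟩ :=
    exists_mem_reflTransGen_of_acyclic hacyc (fun v hv => (hbal v hv).2) ⟨b, hab⟩
  obtain ⟨y, hy, hyb⟩ := exists_mem_reflTransGen_of_acyclic (E := Function.swap E)
    (fun v h => hacyc v (Relation.transGen_swap.1 h)) (fun v hv => (hbal v hv).1) ⟨a, hab⟩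
  refine ⟨x, hx, y, hy, ?_, Relation.ReflTransGen.mono (fun _ _ => Or.inl) _ _ hxa,
    (Relation.ReflTransGen.mono (fun _ _ => Or.inr) _ _ hyb).tail (Or.inr hab)⟩
  rintro rfl
  exact hacyc x ((Relation.TransGen.tail' hxa hab).trans_left (Relation.reflTransGen_swap.1 hyb))
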